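/- Let X be a real Banach space, let S be a nonempty, closed and convex subset of X, and let T : S → S be a weakly sequentially continuous operator such that T(S) is bounded and such that T is condensing with respect to the De Blasi measure of weak noncompactness μ, i.e., for every bounded subset V of S with μ(V) > 0 one has μ(T(V)) < μ(V). Then T has a fixed point in S. -/

import Mathlib

open Filter Topology Pointwise

variable {X : Type*} [NormedAddCommGroup X] [NormedSpace ℝ X]

/-- `u` converges weakly to `x`. -/
def WeakConv (u : ℕ → X) (x : X) : Prop :=
  ∀ f : X →L[ℝ] ℝ, Tendsto (fun n => f (u n)) atTop (𝓝 (f x))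

/-- A set is weakly compact if it is compact in the weak topology `σ(X, X*)`. -/
def WeaklyCompact (K : Set X) : Prop :=
  IsCompact (toWeakSpace ℝ X '' K)

/-- The closure of a set in the weak topology. -/
def weakClosure (S : Set X) : Set X :=
  toWeakSpace ℝ X ⁻¹' closure (toWeakSpace ℝ X '' S)

/-- A set is relatively weakly compact if its weak closure is weakly compact. -/
def RelWeaklyCompact (S : Set X) : Prop :=
  WeaklyCompact (weakClosure S)

/-- The De Blasi measure of weak noncompactness. -/
noncomputable def deBlasi (S : Set X) : ℝ :=
  sInf {r : ℝ | 0 ≤ r ∧ ∃ K : Set X, WeaklyCompact K ∧ S ⊆ K + Metric.closedBall (0 : X) r}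

section Brouwer

open MeasureTheory Set Metric

variable {E : Type*} [NormedAddCommGroup E]

lemma exists_interpolation_weights (d : ℕ) {δ : ℝ} (hδ : 0 < δ) :
    ∃ t w : Fin (d + 1) → ℝ, (∀ i, t i ∈ Icc 0 δ) ∧
      ∀ p : Polynomial ℝ, p.natDegree ≤ d → p.eval 1 = ∑ i, w i * p.eval (t i) := by
  refine ⟨fun i => δ * (i / (d + 1)),
    fun i => (Lagrange.basis Finset.univ (fun i : Fin (d + 1) => δ * (i / (d + 1) : ℝ)) i).eval 1,
    fun i => ⟨by positivity, ?_⟩, fun p hp => ?_⟩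
  · refine mul_le_of_le_one_right hδ.le ((div_le_one (by positivity)).2 ?_)
    exact_mod_cast i.2.le
  · have hinj : Set.InjOn (fun i : Fin (d + 1) => δ * (i / (d + 1) : ℝ))
        (Finset.univ : Finset (Fin (d + 1))) := by
      intro i _ j _ hij
      have h := mul_left_cancel₀ hδ.ne' hij
      rw [div_left_inj' (by positivity)] at h
      exact Fin.ext (by exact_mod_cast h)
    have hdeg : p.degree < (Finset.univ : Finset (Fin (d + 1))).card := by
      rw [Finset.card_univ, Fintype.card_fin]
      exact (Polynomial.degree_le_of_natDegree_le hp).trans_lt (by exact_mod_cast d.lt_succ_self)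
    conv_lhs => rw [Lagrange.eq_interpolate hinj hdeg]
    rw [Lagrange.interpolate_apply, Polynomial.eval_finsetSum]
    exact Finset.sum_congr rfl fun i _ => by simp [mul_comm]

lemma lipschitzWith_indicator_unitBall [NormedSpace ℝ E] {g : E → E} {C : NNReal}
    (hg : LipschitzOnWith C g (Metric.closedBall 0 1)) (hsph : ∀ x, ‖x‖ = 1 → g x = 0) :
    LipschitzWith (2 * C) ((Metric.closedBall (0 : E) 1).indicator g) := by
  have key : ∀ x y : E, ‖x‖ ≤ 1 → 1 < ‖y‖ → ‖g x‖ ≤ 2 * C * ‖x - y‖ := by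
    intro x y hx hy
    have hy0 : ‖y‖ ≠ 0 := by positivity
    set z := ‖y‖⁻¹ • y with hz
    have hz1 : ‖z‖ = 1 := by rw [hz, norm_smul, norm_inv, norm_norm, inv_mul_cancel₀ hy0]
    have h1 : ‖g x - g z‖ ≤ C * ‖x - z‖ := by
      simpa [dist_eq_norm] using hg.dist_le_mul x (by simpa using hx) z (by simp [hz1])
    rw [hsph z hz1, sub_zero] at h1
    have h2 : ‖y - z‖ = ‖y‖ - 1 := by
      have : y - z = (1 - ‖y‖⁻¹) • y := by rw [hz, sub_smul, one_smul]
      rw [this, norm_smul, Real.norm_of_nonneg, sub_mul, inv_mul_cancel₀ hy0, one_mul]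
      exact sub_nonneg.2 (inv_le_one_of_one_le₀ hy.le)
    have h3 : ‖y‖ - ‖x‖ ≤ ‖x - y‖ := by rw [norm_sub_rev]; exact norm_sub_norm_le y x
    have h4 : ‖x - z‖ ≤ ‖x - y‖ + ‖y - z‖ := norm_sub_le_norm_sub_add_norm_sub x y z
    calc ‖g x‖ ≤ C * ‖x - z‖ := h1
      _ ≤ C * (2 * ‖x - y‖) := by gcongr; linarith
      _ = _ := by ring
  refine LipschitzWith.of_dist_le_mul fun x y => ?_
  rw [dist_eq_norm, dist_eq_norm]
  push_cast
  by_cases hx : ‖x‖ ≤ 1 <;> by_cases hy : ‖y‖ ≤ 1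
  · rw [indicator_of_mem (by simpa using hx), indicator_of_mem (by simpa using hy)]
    have := hg.dist_le_mul x (by simpa using hx) y (by simpa using hy)
    rw [dist_eq_norm, dist_eq_norm] at this
    refine this.trans ?_
    have : 0 ≤ C * ‖x - y‖ := by positivity
    linarith
  · rw [indicator_of_mem (by simpa using hx), indicator_of_notMem (by simpa using hy), sub_zero]
    exact key x y hx (not_le.1 hy)
  · rw [indicator_of_notMem (by simpa using hx), indicator_of_mem (by simpa using hy), zero_sub,
      norm_neg, norm_sub_rev]
    exact key y x hy (not_le.1 hx)
  · rw [indicator_of_notMem (by simpa using hx), indicator_of_notMem (by simpa using hy), sub_zero,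
      norm_zero]
    positivity

lemma LipschitzWith.bijective_add_smul [NormedSpace ℝ E] [CompleteSpace E] {g : E → E}
    {K : NNReal} (hg : LipschitzWith K g) {t : ℝ} (ht0 : 0 ≤ t) (ht : t * K < 1) :
    Function.Bijective fun x => x + t • g x := by
  have hdist : ∀ x y, ‖t • g x - t • g y‖ ≤ t * K * ‖x - y‖ := by
    intro x y
    rw [← smul_sub, norm_smul, Real.norm_of_nonneg ht0, mul_assoc]
    gcongr
    simpa [dist_eq_norm] using hg.dist_le_mul x y
  constructor
  · intro x y hxy
    have h1 : x - y = t • g y - t • g x := by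
      simp only at hxy
      rw [sub_eq_sub_iff_add_eq_add, hxy, add_comm]
    have h2 := hdist y x
    rw [← h1, norm_sub_rev y x] at h2
    by_contra hne
    have : 0 < ‖x - y‖ := norm_pos_iff.2 (sub_ne_zero.2 hne)
    nlinarith
  · intro y
    have hc : ContractingWith ⟨t * K, by positivity⟩ fun x => y - t • g x := by
      refine ⟨by exact_mod_cast ht, LipschitzWith.of_dist_le_mul fun a b => ?_⟩
      rw [dist_eq_norm, dist_eq_norm, sub_sub_sub_cancel_left, norm_sub_rev a b]
      exact hdist b a
    refine ⟨ContractingWith.fixedPoint _ hc, ?_⟩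
    have := hc.fixedPoint_isFixedPt
    exact eq_sub_iff_add_eq.1 this.symm

lemma det_id_add_smul_pos [NormedSpace ℝ E] [FiniteDimensional ℝ E] (A : E →L[ℝ] E) {t : ℝ}
    (ht0 : 0 ≤ t) (ht : t * ‖A‖ < 1) : 0 < (ContinuousLinearMap.id ℝ E + t • A).det := by
  have hne : ∀ s ∈ Icc 0 t, (ContinuousLinearMap.id ℝ E + s • A).det ≠ 0 := by
    intro s hs h0
    apply LinearMap.det_eq_zero_iff_ker_ne_bot.1 h0
    rw [LinearMap.ker_eq_bot']
    intro v hv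
    have h1 : v = -(s • A v) := eq_neg_of_add_eq_zero_left hv
    have h2 : ‖v‖ ≤ t * ‖A‖ * ‖v‖ := by
      conv_lhs => rw [h1, norm_neg, norm_smul, Real.norm_of_nonneg hs.1]
      rw [mul_assoc]
      gcongr
      · exact hs.2
      · exact A.le_opNorm v
    by_contra hv0
    have : 0 < ‖v‖ := norm_pos_iff.2 hv0
    nlinarith
  by_contra! hle
  have hcont : ContinuousOn (fun s : ℝ => (ContinuousLinearMap.id ℝ E + s • A).det) (Icc 0 t) :=
    (ContinuousLinearMap.continuous_det.comp (by fun_prop)).continuousOn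
  obtain ⟨s, hs, hs0⟩ := intermediate_value_Icc' ht0 hcont
    (show (0 : ℝ) ∈ Icc _ _ from ⟨hle, by simp [ContinuousLinearMap.det]⟩)
  exact hne s hs hs0

lemma exists_polynomial_det_id_add_smul [NormedSpace ℝ E] [FiniteDimensional ℝ E]
    (A : E →L[ℝ] E) : ∃ p : Polynomial ℝ, p.natDegree ≤ Module.finrank ℝ E ∧
      ∀ t : ℝ, p.eval t = (ContinuousLinearMap.id ℝ E + t • A).det := by
  classical
  let b := Module.finBasis ℝ E
  refine ⟨((Polynomial.X : Polynomial ℝ) •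
    (LinearMap.toMatrix b b (A : E →ₗ[ℝ] E)).map (Polynomial.C (R := ℝ)) +
    (1 : Matrix (Fin (Module.finrank ℝ E)) (Fin (Module.finrank ℝ E)) ℝ).map
      (Polynomial.C (R := ℝ))).det, ?_, fun t => ?_⟩
  · simpa using Polynomial.natDegree_det_X_add_C_le (LinearMap.toMatrix b b (A : E →ₗ[ℝ] E)) 1
  · rw [← Polynomial.coe_evalRingHom, RingHom.map_det, ContinuousLinearMap.det,
      ← LinearMap.det_toMatrix b]
    congr 1
    ext i j
    simp [Matrix.one_apply, add_comm, LinearMap.toMatrix_apply, Finsupp.single_apply,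
      apply_ite (Polynomial.eval t), eq_comm]
    ring

variable [InnerProductSpace ℝ E] [FiniteDimensional ℝ E]

lemma exists_det_fderiv_ne_zero_of_eqOn_sphere {r : E → E} {U : Set E} (hU : IsOpen U)
    (hBU : Metric.closedBall 0 1 ⊆ U) (hr : ContDiffOn ℝ 1 r U)
    (hmaps : MapsTo r (Metric.closedBall 0 1) (Metric.closedBall 0 1))
    (hsph : ∀ x, ‖x‖ = 1 → r x = x) :
    ∃ x ∈ Metric.closedBall (0 : E) 1, (fderiv ℝ r x).det ≠ 0 := by
  by_contra! hdet
  borelize E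
  let B := Metric.closedBall (0 : E) 1
  have hBc : IsCompact B := isCompact_closedBall 0 1
  let A : E → E →L[ℝ] E := fun x => fderiv ℝ r x - ContinuousLinearMap.id ℝ E
  let g : E → E := fun x => r x - x
  have hgA : ∀ x ∈ B, HasFDerivWithinAt g (A x) B x := fun x hx =>
    ((((hr.differentiableOn one_ne_zero).differentiableAt
      (hU.mem_nhds (hBU hx))).hasFDerivAt).sub (hasFDerivAt_id x)).hasFDerivWithinAt
  have hAcont : ContinuousOn A B :=
    ((hr.continuousOn_fderiv_of_isOpen hU le_rfl).mono hBU).sub continuousOn_const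
  obtain ⟨C₀, hC₀⟩ := hBc.exists_bound_of_continuousOn hAcont
  obtain ⟨C, hC⟩ : ∃ C : NNReal, ∀ x ∈ B, ‖A x‖₊ ≤ C :=
    ⟨C₀.toNNReal, fun x hx => by
      rw [← norm_toNNReal]; exact Real.toNNReal_le_toNNReal (hC₀ x hx)⟩
  have hglip : LipschitzOnWith C g B :=
    (convex_closedBall 0 1).lipschitzOnWith_of_nnnorm_hasFDerivWithin_le hgA hC
  have hGlip := lipschitzWith_indicator_unitBall hglip fun x hx => by simp [g, hsph x hx]
  obtain ⟨δ, hδ0, hδ_one, hδ1⟩ : ∃ δ : ℝ, 0 < δ ∧ δ ≤ 1 ∧ δ * (2 * C) < 1 :=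
    ⟨1 / (2 * C + 1), by positivity, by
      rw [div_le_one (by positivity)]; linarith [C.coe_nonneg], by
      rw [one_div, inv_mul_lt_iff₀ (by positivity)]; linarith⟩
  have hδ : ∀ t ∈ Icc 0 δ, t * (2 * C) < 1 := fun t ht =>
    (mul_le_mul_of_nonneg_right ht.2 (by positivity)).trans_lt hδ1
  have hvol : ∀ t ∈ Icc 0 δ,
      ∫ x in B, (ContinuousLinearMap.id ℝ E + t • A x).det = volume.real B := by
    intro t ht
    have hbij := hGlip.bijective_add_smul ht.1 (by exact_mod_cast hδ t ht)
    have heq : EqOn (fun x => x + t • g x) (fun x => x + t • B.indicator g x) B := fun x hx => by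
      simp only [indicator_of_mem hx]
    have hinj : InjOn (fun x => x + t • g x) B := hbij.1.injOn.congr heq.symm
    have himage : (fun x => x + t • g x) '' B = B := by
      refine Subset.antisymm ?_ fun y hy => ?_
      · rintro _ ⟨x, hx, rfl⟩
        have : x + t • g x = (1 - t) • x + t • r x := by
          simp only [g, smul_sub, sub_smul, one_smul]; abel
        simp only [this]
        exact convex_closedBall 0 1 hx (hmaps hx) (by linarith [ht.2]) ht.1 (by ring)
      · obtain ⟨x, hx⟩ := hbij.2 y
        have hxB : x ∈ B := by
          by_contra hxB
          simp only [B, indicator_of_notMem hxB, smul_zero, add_zero] at hx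
          exact hxB (hx ▸ hy)
        exact ⟨x, hxB, (heq hxB).trans hx⟩
    have hderiv : ∀ x ∈ B, HasFDerivWithinAt (fun x => x + t • g x)
        (ContinuousLinearMap.id ℝ E + t • A x) B x := fun x hx =>
      (hasFDerivWithinAt_id x B).add ((hgA x hx).const_smul t)
    have hpos : ∀ x ∈ B, 0 < (ContinuousLinearMap.id ℝ E + t • A x).det := fun x hx => by
      refine det_id_add_smul_pos _ ht.1 (lt_of_le_of_lt ?_ (hδ t ht))
      have h1 : ‖A x‖ ≤ C := hC x hx
      have := C.coe_nonneg
      exact mul_le_mul_of_nonneg_left (by linarith) ht.1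
    have hcv := integral_image_eq_integral_abs_det_fderiv_smul volume
      hBc.measurableSet hderiv hinj (fun _ => (1 : ℝ))
    rw [himage] at hcv
    simp only [smul_eq_mul, mul_one, integral_const, MeasurableSet.univ, measureReal_restrict_apply,
      univ_inter] at hcv
    rw [hcv]
    exact setIntegral_congr_fun hBc.measurableSet fun x hx => (abs_of_pos (hpos x hx)).symm
  obtain ⟨t, w, ht, hw⟩ := exists_interpolation_weights (Module.finrank ℝ E) hδ0
  have hinterp : ∀ x, (ContinuousLinearMap.id ℝ E + (1 : ℝ) • A x).det =
      ∑ i, w i * (ContinuousLinearMap.id ℝ E + t i • A x).det := fun x => by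
    obtain ⟨p, hp, hpe⟩ := exists_polynomial_det_id_add_smul (A x)
    simp only [← hpe]
    exact hw p hp
  have hsum : ∑ i, w i = 1 := by simpa using (hw 1 (by simp)).symm
  have hint : ∀ s : ℝ, IntegrableOn
      (fun x => (ContinuousLinearMap.id ℝ E + s • A x).det) B := fun s =>
    (ContinuousLinearMap.continuous_det.comp_continuousOn
      (continuousOn_const.add (hAcont.const_smul s))).integrableOn_compact hBc
  have hzero : ∫ x in B, (ContinuousLinearMap.id ℝ E + (1 : ℝ) • A x).det = 0 := by
    refine setIntegral_eq_zero_of_forall_eq_zero fun x hx => ?_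
    simpa [A] using hdet x hx
  have hone : ∫ x in B, (ContinuousLinearMap.id ℝ E + (1 : ℝ) • A x).det = volume.real B := by
    simp only [hinterp]
    rw [integral_finsetSum _ fun i _ => (hint (t i)).const_mul (w i)]
    simp only [integral_const_mul, hvol _ (ht _), ← Finset.sum_mul, hsum, one_mul]
  have hBpos : 0 < volume.real B :=
    ENNReal.toReal_pos (Metric.measure_closedBall_pos volume 0 one_pos).ne'
      hBc.measure_lt_top.ne
  linarith

open scoped RealInnerProductSpace in
lemma det_fderiv_eq_zero_of_norm_eq_one {r : E → E} {U : Set E} (hU : IsOpen U)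
    (hnorm : ∀ x ∈ U, ‖r x‖ = 1) {x : E} (hx : x ∈ U) (hr : DifferentiableAt ℝ r x) :
    (fderiv ℝ r x).det = 0 := by
  by_contra hdet
  have hrange : (fderiv ℝ r x : E →ₗ[ℝ] E).range = ⊤ := by
    by_contra h
    exact hdet (LinearMap.det_eq_zero_iff_ker_ne_bot.2
      fun hk => h (LinearMap.ker_eq_bot_iff_range_eq_top.1 hk))
  obtain ⟨v, hv⟩ := LinearMap.range_eq_top.1 hrange (r x)
  have hconst : (fun y => ⟪r y, r y⟫) =ᶠ[𝓝 x] fun _ => (1 : ℝ) := by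
    filter_upwards [hU.mem_nhds hx] with y hy
    rw [real_inner_self_eq_norm_sq, hnorm y hy, one_pow]
  have h1 : fderiv ℝ (fun y => ⟪r y, r y⟫) x v = 0 := by
    rw [hconst.fderiv_eq]; simp
  rw [fderiv_inner_apply ℝ hr hr] at h1
  have hv' : fderiv ℝ r x v = r x := hv
  rw [hv', real_inner_self_eq_norm_sq, hnorm x hx] at h1
  norm_num at h1

open scoped RealInnerProductSpace in
lemma ContDiff.exists_fixedPoint_unitBall {f : E → E} (hf : ContDiff ℝ 1 f)
    (hmaps : MapsTo f (Metric.closedBall 0 1) (Metric.closedBall 0 1)) :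
    ∃ x ∈ Metric.closedBall (0 : E) 1, f x = x := by
  by_contra! hfix
  let d : E → E := fun x => x - f x
  let D : E → ℝ := fun x => (⟪x, d x⟫) ^ 2 + ‖d x‖ ^ 2 * (1 - ‖x‖ ^ 2)
  let s : E → ℝ := fun x => (-⟪x, d x⟫ + √(D x)) / ‖d x‖ ^ 2
  let r : E → E := fun x => x + s x • d x
  let U : Set E := {x | d x ≠ 0} ∩ {x | 0 < D x}
  have hd : ContDiff ℝ 1 d := contDiff_id.sub hf
  have hD : ContDiff ℝ 1 D :=
    ((contDiff_id.inner ℝ hd).pow 2).add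
      ((hd.norm_sq ℝ).mul (contDiff_const.sub (contDiff_id.norm_sq ℝ)))
  have hU : IsOpen U :=
    (isOpen_ne_fun hd.continuous continuous_const).inter
      (isOpen_lt continuous_const hD.continuous)
  have hsph : ∀ x, ‖x‖ = 1 → d x ≠ 0 → 0 < ⟪x, d x⟫ := by
    intro x hx hdx
    have h1 : ‖f x‖ ≤ 1 := by simpa using hmaps (show x ∈ Metric.closedBall 0 1 by simp [hx])
    have h2 : 0 < ‖d x‖ := norm_pos_iff.2 hdx
    have h3 : ‖d x‖ ^ 2 = ‖x‖ ^ 2 - 2 * ⟪x, f x⟫ + ‖f x‖ ^ 2 := norm_sub_sq_real x (f x)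
    have h4 : ⟪x, d x⟫ = ‖x‖ ^ 2 - ⟪x, f x⟫ := by
      simp only [d, inner_sub_right, real_inner_self_eq_norm_sq]
    rw [hx] at h3 h4
    nlinarith [norm_nonneg (f x)]
  have hdB : ∀ x ∈ Metric.closedBall (0 : E) 1, d x ≠ 0 := fun x hx =>
    sub_ne_zero.2 (hfix x hx).symm
  have hBU : Metric.closedBall 0 1 ⊆ U := by
    intro x hx
    refine ⟨hdB x hx, ?_⟩
    have hx1 : ‖x‖ ≤ 1 := by simpa using hx
    have h2 : 0 < ‖d x‖ := norm_pos_iff.2 (hdB x hx)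
    rcases hx1.lt_or_eq with h | h
    · have : 0 < 1 - ‖x‖ ^ 2 := by nlinarith [norm_nonneg x]
      show 0 < ⟪x, d x⟫ ^ 2 + ‖d x‖ ^ 2 * (1 - ‖x‖ ^ 2)
      positivity
    · have := hsph x h (hdB x hx)
      show 0 < ⟪x, d x⟫ ^ 2 + ‖d x‖ ^ 2 * (1 - ‖x‖ ^ 2)
      rw [h]
      norm_num
      positivity
  have hs : ContDiffOn ℝ 1 s U := by
    refine ContDiffOn.div ?_ (hd.norm_sq ℝ).contDiffOn fun x hx => ?_
    · exact (contDiff_id.inner ℝ hd).neg.contDiffOn.add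
        (hD.contDiffOn.sqrt fun x hx => hx.2.ne')
    · exact pow_ne_zero 2 (norm_ne_zero_iff.2 hx.1)
  have hr : ContDiffOn ℝ 1 r U := contDiff_id.contDiffOn.add (hs.smul hd.contDiffOn)
  have hnorm : ∀ x ∈ U, ‖r x‖ = 1 := by
    intro x hx
    have h2 : ‖d x‖ ^ 2 ≠ 0 := pow_ne_zero 2 (norm_ne_zero_iff.2 hx.1)
    have h3 : s x * ‖d x‖ ^ 2 = -⟪x, d x⟫ + √(D x) := div_mul_cancel₀ _ h2
    have h4 : √(D x) ^ 2 = ⟪x, d x⟫ ^ 2 + ‖d x‖ ^ 2 * (1 - ‖x‖ ^ 2) :=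
      Real.sq_sqrt hx.2.le
    have h5 : ‖r x‖ ^ 2 = ‖x‖ ^ 2 + 2 * (s x * ⟪x, d x⟫) + s x ^ 2 * ‖d x‖ ^ 2 := by
      rw [norm_add_sq_real, norm_smul, real_inner_smul_right, mul_pow, Real.norm_eq_abs, sq_abs]
    have h6 : ‖d x‖ ^ 2 * (‖r x‖ ^ 2 - 1) = 0 := by
      have : √(D x) = s x * ‖d x‖ ^ 2 + ⟪x, d x⟫ := by linarith
      rw [this] at h4
      rw [h5]
      linear_combination h4
    have h7 : ‖r x‖ ^ 2 = 1 := by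
      have := (mul_eq_zero.1 h6).resolve_left h2
      linarith
    exact (pow_eq_one_iff_of_nonneg (norm_nonneg _) two_ne_zero).1 h7
  have hrsph : ∀ x, ‖x‖ = 1 → r x = x := by
    intro x hx
    have hxB : x ∈ Metric.closedBall (0 : E) 1 := by simp [hx]
    have hDx : D x = ⟪x, d x⟫ ^ 2 := by simp [D, hx]
    have hsx : s x = 0 := by
      simp only [s]
      rw [hDx, Real.sqrt_sq (hsph x hx (hdB x hxB)).le]
      simp
    simp [r, hsx]
  obtain ⟨x, hx, hdet⟩ := exists_det_fderiv_ne_zero_of_eqOn_sphere hU hBU hr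
    (fun x hx => by simp [hnorm x (hBU hx)]) hrsph
  exact hdet (det_fderiv_eq_zero_of_norm_eq_one hU hnorm (hBU hx)
    ((hr.differentiableOn one_ne_zero).differentiableAt (hU.mem_nhds (hBU hx))))

/-- **Brouwer's fixed point theorem**, for continuous self-maps with bounded range. -/
theorem Continuous.exists_fixedPoint_of_norm_le {f : E → E} (hf : Continuous f) {R : ℝ}
    (hR : ∀ x, ‖f x‖ ≤ R) : ∃ x, f x = x := by
  have hR0 : 0 ≤ R := (norm_nonneg _).trans (hR 0)
  have hρ : 0 < R + 1 := by linarith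
  have happrox : ∀ ε : ℝ, 0 < ε → ε ≤ 1 →
      ∃ x ∈ Metric.closedBall (0 : E) (R + 1), ‖f x - x‖ ≤ ε := by
    intro ε hε hε1
    obtain ⟨g, hg, hgf, -⟩ := hf.exists_contDiff_approx 1 (continuous_const (y := ε)) fun _ => hε
    have hgR : ∀ x, ‖g x‖ ≤ R + 1 := fun x => by
      have h1 := hgf x
      rw [dist_eq_norm] at h1
      have h2 := norm_sub_norm_le (g x) (f x)
      linarith [hR x]
    obtain ⟨x, hx, hfx⟩ := ContDiff.exists_fixedPoint_unitBall
      (f := fun x => (R + 1)⁻¹ • g ((R + 1) • x))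
      (((hg.of_le le_rfl).comp (contDiff_id.const_smul _)).const_smul _) (by
        intro x _
        rw [mem_closedBall_zero_iff, norm_smul, norm_inv, Real.norm_of_nonneg hρ.le,
          inv_mul_le_iff₀ hρ]
        simpa using hgR _)
    refine ⟨(R + 1) • x, ?_, ?_⟩
    · rw [mem_closedBall_zero_iff] at hx ⊢
      rw [norm_smul, Real.norm_of_nonneg hρ.le]
      exact mul_le_of_le_one_right hρ.le hx
    · have h1 : g ((R + 1) • x) = (R + 1) • x := by
        conv_rhs => rw [← hfx, smul_inv_smul₀ hρ.ne']
      have h2 := hgf ((R + 1) • x)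
      rw [h1, dist_eq_norm, norm_sub_rev] at h2
      exact h2.le
  obtain ⟨x, -, hmin⟩ := (isCompact_closedBall (0 : E) (R + 1)).exists_isMinOn
    ⟨0, by simp [hρ.le]⟩ ((hf.sub continuous_id).norm.continuousOn)
  refine ⟨x, sub_eq_zero.1 (norm_eq_zero.1 (le_antisymm ?_ (norm_nonneg _)))⟩
  refine le_of_forall_pos_le_add fun ε hε => ?_
  obtain ⟨y, hy, hfy⟩ := happrox (min ε 1) (lt_min hε one_pos) (min_le_right _ _)
  have h1 : ‖f x - x‖ ≤ ‖f y - y‖ := hmin hy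
  linarith [min_le_left ε 1]

end Brouwer

section ApproximateFixedPoints

open Set

/-- The value at `x` of a continuous retraction of `ι → ℝ` onto the standard simplex. -/
noncomputable def simplexRetract {ι : Type*} [Fintype ι] (x : ι → ℝ) : ι → ℝ := fun i =>
  (max (x i) 0 + max (1 - ∑ j, max (x j) 0) 0 / Fintype.card ι) / max (∑ j, max (x j) 0) 1

lemma continuous_simplexRetract {ι : Type*} [Fintype ι] :
    Continuous (simplexRetract : (ι → ℝ) → ι → ℝ) := by
  refine continuous_pi fun i => Continuous.div (by fun_prop) (by fun_prop) fun x => ?_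
  exact (one_pos.trans_le (le_max_right _ _)).ne'

lemma simplexRetract_mem {ι : Type*} [Fintype ι] [Nonempty ι] (x : ι → ℝ) :
    simplexRetract x ∈ stdSimplex ℝ ι := by
  have hpos : 0 < max (∑ j, max (x j) 0) 1 := one_pos.trans_le (le_max_right _ _)
  refine ⟨fun i => div_nonneg (by positivity) hpos.le, ?_⟩
  have hcard : (Fintype.card ι : ℝ) ≠ 0 := by positivity
  simp only [simplexRetract]
  rw [← Finset.sum_div, Finset.sum_add_distrib, Finset.sum_const, Finset.card_univ, nsmul_eq_mul,
    mul_div_cancel₀ _ hcard, div_eq_one_iff_eq hpos.ne']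
  rcases le_total (∑ j, max (x j) 0) 1 with h | h
  · rw [max_eq_left (by linarith), max_eq_right h]; ring
  · rw [max_eq_right (by linarith), max_eq_left h, add_zero]

lemma simplexRetract_eq_self {ι : Type*} [Fintype ι] {x : ι → ℝ} (hx : x ∈ stdSimplex ℝ ι) :
    simplexRetract x = x := by
  have h : ∑ j, max (x j) 0 = 1 := by
    rw [← hx.2]
    exact Finset.sum_congr rfl fun j _ => max_eq_left (hx.1 j)
  ext i
  simp [simplexRetract, h, hx.1 i]

theorem exists_fixedPoint_stdSimplex {ι : Type*} [Fintype ι] [Nonempty ι]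
    {F : (ι → ℝ) → ι → ℝ} (hF : ContinuousOn F (stdSimplex ℝ ι))
    (hmaps : MapsTo F (stdSimplex ℝ ι) (stdSimplex ℝ ι)) : ∃ x ∈ stdSimplex ℝ ι, F x = x := by
  have hcont : Continuous fun x : EuclideanSpace ℝ ι =>
      WithLp.toLp 2 (F (simplexRetract (WithLp.ofLp x))) :=
    (PiLp.continuous_toLp 2 _).comp (hF.comp_continuous
      (continuous_simplexRetract.comp (PiLp.continuous_ofLp 2 _)) fun _ => simplexRetract_mem _)
  obtain ⟨R, hR⟩ := ((isCompact_stdSimplex ℝ ι).image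
    (PiLp.continuous_toLp 2 fun _ : ι => ℝ)).isBounded.exists_norm_le
  obtain ⟨x, hx⟩ := hcont.exists_fixedPoint_of_norm_le fun x =>
    hR _ (mem_image_of_mem _ (hmaps (simplexRetract_mem _)))
  have hx' : F (simplexRetract (WithLp.ofLp x)) = WithLp.ofLp x := congrArg WithLp.ofLp hx
  have hmem : WithLp.ofLp x ∈ stdSimplex ℝ ι := hx' ▸ hmaps (simplexRetract_mem _)
  refine ⟨_, hmem, ?_⟩
  rwa [simplexRetract_eq_self hmem] at hx'

lemma exists_forall_abs_sub_le_of_weaklySeqContinuous {K : Set X} (hne : K.Nonempty)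
    (hconv : Convex ℝ K) (hbdd : Bornology.IsBounded K) {T : X → X} (hmaps : MapsTo T K K)
    (hwsc : ∀ (u : ℕ → X) (x : X), (∀ n, u n ∈ K) → x ∈ K →
      WeakConv u x → WeakConv (fun n => T (u n)) (T x))
    {ι : Type*} [Fintype ι] (f : ι → X →L[ℝ] ℝ) {ε : ℝ} (hε : 0 < ε) :
    ∃ x ∈ K, ∀ i, |f i (T x) - f i x| ≤ ε := by
  classical
  let Φ : X →L[ℝ] (ι → ℝ) := ContinuousLinearMap.pi f
  have htb : TotallyBounded (Φ '' K) := by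
    obtain ⟨R, hR⟩ := hbdd.exists_norm_le
    refine (isCompact_closedBall (0 : ι → ℝ) (‖Φ‖ * R)).totallyBounded.subset ?_
    rintro _ ⟨x, hx, rfl⟩
    rw [mem_closedBall_zero_iff]
    exact (Φ.le_opNorm x).trans (by gcongr; exact hR x hx)
  obtain ⟨t, htK, htfin, hcover⟩ := Metric.finite_approx_of_totallyBounded htb ε hε
  have hcover' : ∀ x ∈ K, ∃ y : t, dist (Φ x) y < ε := fun x hx => by
    obtain ⟨y, hy, hxy⟩ := mem_iUnion₂.1 (hcover (mem_image_of_mem Φ hx))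
    exact ⟨⟨y, hy⟩, hxy⟩
  choose k hkK hk using fun y : t => htK y.2
  have := htfin.fintype
  have : Nonempty t := let ⟨x, hx⟩ := hne; ⟨(hcover' x hx).choose⟩
  let φ : t → (ι → ℝ) → ℝ := fun j v => max (ε - dist v j) 0
  have hφ0 : ∀ j v, 0 ≤ φ j v := fun j v => le_max_right _ _
  have hφc : ∀ j, Continuous (φ j) := fun j => by fun_prop
  have hsum : ∀ x ∈ K, 0 < ∑ j, φ j (Φ x) := fun x hx => by
    obtain ⟨y, hy⟩ := hcover' x hx
    exact Finset.sum_pos' (fun j _ => hφ0 j _)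
      ⟨y, Finset.mem_univ _, lt_max_of_lt_left (sub_pos.2 hy)⟩
  let c : (t → ℝ) → X := fun l => ∑ j, l j • k j
  have hcK : MapsTo c (stdSimplex ℝ t) K := fun l hl =>
    hconv.sum_mem (fun j _ => hl.1 j) hl.2 fun j _ => hkK j
  have hcc : Continuous c := by fun_prop
  have hΦT : ContinuousOn (fun l => Φ (T (c l))) (stdSimplex ℝ t) := by
    rw [continuousOn_iff_continuous_domRestrict, continuous_iff_seqContinuous]
    intro u l hul
    have hu : Tendsto (fun n => c (u n)) atTop (𝓝 (c l)) :=
      (hcc.comp continuous_subtype_val).continuousAt.tendsto.comp hul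
    have hT := hwsc (fun n => c (u n)) (c l) (fun n => hcK (u n).2) (hcK l.2)
      fun g => (g.continuous.tendsto _).comp hu
    exact tendsto_pi_nhds.2 fun i => hT (f i)
  obtain ⟨l, hl, hfix⟩ := exists_fixedPoint_stdSimplex
    (F := fun l j => φ j (Φ (T (c l))) / ∑ i, φ i (Φ (T (c l))))
    (continuousOn_pi.2 fun j => ((hφc j).comp_continuousOn hΦT).div
      (continuousOn_finsetSum _ fun i _ => (hφc i).comp_continuousOn hΦT)
      fun l hl => (hsum _ (hmaps (hcK hl))).ne')
    (fun l hl => ⟨fun j => div_nonneg (hφ0 _ _) (hsum _ (hmaps (hcK hl))).le, by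
      rw [← Finset.sum_div, div_self (hsum _ (hmaps (hcK hl))).ne']⟩)
  refine ⟨c l, hcK hl, fun i => ?_⟩
  have hle : ‖Φ (T (c l)) - Φ (c l)‖ ≤ ε := by
    have h1 : Φ (T (c l)) - Φ (c l) = ∑ j, l j • (Φ (T (c l)) - j) := by
      simp only [smul_sub, Finset.sum_sub_distrib, ← Finset.sum_smul, hl.2, one_smul]
      simp only [c, map_sum, map_smul, hk]
    rw [h1]
    refine (norm_sum_le _ _).trans ?_
    calc ∑ j, ‖l j • (Φ (T (c l)) - (j : ι → ℝ))‖ ≤ ∑ j, l j * ε := by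
          refine Finset.sum_le_sum fun j _ => ?_
          rw [norm_smul, Real.norm_of_nonneg (hl.1 j)]
          by_cases h : dist (Φ (T (c l))) j < ε
          · rw [dist_eq_norm] at h
            exact mul_le_mul_of_nonneg_left h.le (hl.1 j)
          · have hj : l j = 0 := by
              rw [← hfix]
              simp only [φ, max_eq_right (sub_nonpos.2 (not_lt.1 h)), zero_div]
            simp [hj]
      _ = ε := by rw [← Finset.sum_mul, hl.2, one_mul]
  exact (norm_le_pi_norm (Φ (T (c l)) - Φ (c l)) i).trans hle

end ApproximateFixedPoints

section WeakCompactness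

open Set TopologicalSpace

lemma tendsto_toWeakSpace_iff {α : Type*} {l : Filter α} {u : α → X} {x : X} :
    Tendsto (fun a => toWeakSpace ℝ X (u a)) l (𝓝 (toWeakSpace ℝ X x)) ↔
      ∀ f : X →L[ℝ] ℝ, Tendsto (fun a => f (u a)) l (𝓝 (f x)) := by
  refine WeakBilin.tendsto_iff_forall_eval_tendsto (topDualPairing ℝ X).flip fun y z h => ?_
  exact (SeparatingDual.eq_iff_forall_dual_eq (R := ℝ)).2 fun f => LinearMap.congr_fun h f

lemma weaklyCompact_iff_ultrafilter {K : Set X} :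
    WeaklyCompact K ↔ ∀ U : Ultrafilter X, K ∈ U →
      ∃ x ∈ K, ∀ f : X →L[ℝ] ℝ, Tendsto f U (𝓝 (f x)) := by
  rw [WeaklyCompact, isCompact_iff_ultrafilter_le_nhds]
  constructor
  · intro h U hU
    obtain ⟨_, ⟨x, hx, rfl⟩, hle⟩ := h (U.map (toWeakSpace ℝ X))
      (le_principal_iff.2 (image_mem_map hU))
    exact ⟨x, hx, tendsto_toWeakSpace_iff.1 hle⟩
  · intro h U hU
    have hU' : K ∈ U.map (toWeakSpace ℝ X).symm := by
      filter_upwards [le_principal_iff.1 hU]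
      rintro _ ⟨x, hx, rfl⟩
      exact hx
    obtain ⟨x, hx, hlim⟩ := h _ hU'
    refine ⟨_, mem_image_of_mem _ hx, ?_⟩
    have := tendsto_toWeakSpace_iff.2 hlim
    rw [Ultrafilter.coe_map, tendsto_map'_iff] at this
    simpa only [Function.comp_def, LinearEquiv.apply_symm_apply] using! this

lemma mem_of_forall_tendsto_dual {α : Type*} {l : Filter α} [l.NeBot] {u : α → X} {x : X}
    {C : Set X} (hC : Convex ℝ C) (hCc : IsClosed C) (hu : ∀ᶠ a in l, u a ∈ C)
    (hlim : ∀ f : X →L[ℝ] ℝ, Tendsto (fun a => f (u a)) l (𝓝 (f x))) : x ∈ C := by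
  by_contra hx
  obtain ⟨f, c, hc, hfx⟩ := geometric_hahn_banach_closed_point hC hCc hx
  exact hfx.not_ge (le_of_tendsto (hlim f) (hu.mono fun a ha => (hc _ ha).le))

lemma WeaklyCompact.inter_of_convex_of_isClosed {K C : Set X} (hK : WeaklyCompact K)
    (hC : Convex ℝ C) (hCc : IsClosed C) : WeaklyCompact (K ∩ C) := by
  rw [weaklyCompact_iff_ultrafilter] at hK ⊢
  intro U hU
  obtain ⟨x, hx, hlim⟩ := hK U (mem_of_superset hU inter_subset_left)
  exact ⟨x, ⟨hx, mem_of_forall_tendsto_dual (l := (U : Filter X)) (u := fun x => x) hC hCc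
    (mem_of_superset hU inter_subset_right) hlim⟩, hlim⟩

lemma WeaklyCompact.insert {K : Set X} (hK : WeaklyCompact K) (x : X) :
    WeaklyCompact (insert x K) := by
  rw [WeaklyCompact, image_insert_eq]
  exact IsCompact.insert hK _

lemma WeaklyCompact.isClosed_add_closedBall {K : Set X} (hK : WeaklyCompact K) (r : ℝ) :
    IsClosed (K + Metric.closedBall (0 : X) r) := by
  have hball : IsClosed (toWeakSpace ℝ X '' Metric.closedBall (0 : X) r) := by
    have := (convex_closedBall (0 : X) r).toWeakSpace_closure (𝕜 := ℝ)
    rw [Metric.isClosed_closedBall.closure_eq] at this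
    rw [this]
    exact isClosed_closure
  have hsum := hball.add_left_of_isCompact hK
  have := hsum.preimage (toWeakSpaceCLM ℝ X).continuous
  convert this using 1
  rw [← image_add]
  exact (preimage_image_eq _ (toWeakSpace ℝ X).injective).symm

lemma weaklyCompact_of_forall_subset_add_closedBall [CompleteSpace X] {K : Set X}
    (hconv : Convex ℝ K) (hcl : IsClosed K)
    (h : ∀ ε > 0, ∃ K' : Set X, WeaklyCompact K' ∧ K ⊆ K' + Metric.closedBall (0 : X) ε) :
    WeaklyCompact K := by
  rw [weaklyCompact_iff_ultrafilter]
  intro U hU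
  have hε : ∀ n : ℕ, (0 : ℝ) < 1 / (n + 1) := fun n => Nat.one_div_pos_of_nat
  have hex : ∀ n : ℕ, ∃ φ : X → X, ∃ y : X, (∀ x ∈ K, ‖x - φ x‖ ≤ 1 / (n + 1)) ∧
      ∀ f : X →L[ℝ] ℝ, Tendsto (fun x => f (φ x)) U (𝓝 (f y)) := by
    intro n
    obtain ⟨K', hK', hsub⟩ := h _ (hε n)
    have : ∀ x, ∃ k, x ∈ K → k ∈ K' ∧ ‖x - k‖ ≤ 1 / (n + 1) := by
      intro x
      by_cases hx : x ∈ K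
      · obtain ⟨k, hk, b, hb, rfl⟩ := hsub hx
        exact ⟨k, fun _ => ⟨hk, by simpa using hb⟩⟩
      · exact ⟨x, fun h => absurd h hx⟩
    choose φ hφ using this
    obtain ⟨y, -, hy⟩ := weaklyCompact_iff_ultrafilter.1 hK' (U.map φ)
      (Ultrafilter.mem_map.2 (mem_of_superset hU fun x hx => (hφ x hx).1))
    exact ⟨φ, y, fun x hx => (hφ x hx).2, fun f => (hy f).comp tendsto_map⟩
  choose φ y hφ hy using hex
  have hdist : ∀ n m : ℕ, ‖y n - y m‖ ≤ 1 / (n + 1) + 1 / (m + 1) := by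
    intro n m
    have := mem_of_forall_tendsto_dual (l := U) (u := fun x => φ n x - φ m x) (x := y n - y m)
      (convex_closedBall (0 : X) (1 / (n + 1) + 1 / (m + 1))) Metric.isClosed_closedBall
      (by
        filter_upwards [hU] with x hx
        rw [mem_closedBall_zero_iff]
        have h1 := norm_sub_le_norm_sub_add_norm_sub (φ n x) x (φ m x)
        rw [norm_sub_rev (φ n x) x] at h1
        exact h1.trans (add_le_add (hφ n x hx) (hφ m x hx)))
      (fun f => by simpa only [map_sub] using (hy n f).sub (hy m f))
    simpa using this
  have hlim0 : Tendsto (fun n : ℕ => 1 / ((n : ℝ) + 1)) atTop (𝓝 0) :=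
    tendsto_one_div_add_atTop_nhds_zero_nat
  have hcauchy : CauchySeq y := by
    refine cauchySeq_of_le_tendsto_0 (fun n : ℕ => 1 / ((n : ℝ) + 1) + 1 / (n + 1))
      (fun n m N hn hm => ?_) (by simpa using hlim0.add hlim0)
    rw [dist_eq_norm]
    refine (hdist n m).trans (add_le_add ?_ ?_) <;>
      exact one_div_le_one_div_of_le (by positivity) (by gcongr)
  obtain ⟨z, hz⟩ := cauchySeq_tendsto_of_complete hcauchy
  have hlim : ∀ f : X →L[ℝ] ℝ, Tendsto f U (𝓝 (f z)) := by
    intro f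
    rw [Metric.tendsto_nhds]
    intro η hη
    have h1 : Tendsto (fun n : ℕ => ‖f‖ * (1 / ((n : ℝ) + 1)) + ‖f (y n) - f z‖) atTop (𝓝 0) := by
      have := (hlim0.const_mul ‖f‖).add
        (((f.continuous.tendsto z).comp hz).sub_const (f z)).norm
      simpa using this
    obtain ⟨n, hn⟩ := (h1.eventually (gt_mem_nhds (half_pos hη))).exists
    filter_upwards [hU, Metric.tendsto_nhds.1 (hy n f) _ (half_pos hη)] with x hx hx'
    rw [Real.dist_eq] at hx' ⊢
    have h2 : |f x - f (φ n x)| ≤ ‖f‖ * (1 / ((n : ℝ) + 1)) := by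
      rw [← map_sub]
      exact (f.le_opNorm _).trans (by gcongr; exact hφ n x hx)
    have h3 : |f x - f z| ≤ |f x - f (φ n x)| + |f (φ n x) - f (y n)| + |f (y n) - f z| :=
      (abs_sub_le _ (f (y n)) _).trans (by gcongr; exact abs_sub_le _ _ _)
    rw [Real.norm_eq_abs] at hn
    linarith
  exact ⟨z, mem_of_forall_tendsto_dual (l := (U : Filter X)) (u := fun x => x) hconv hcl hU hlim,
    hlim⟩

end WeakCompactness

section WeakKrein

open Set TopologicalSpace MeasureTheory

lemma isClosed_preimage_of_convex {Ω : Type*} [TopologicalSpace Ω] {φ : Ω → X}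
    (hφ : ∀ f : X →L[ℝ] ℝ, Continuous fun ω => f (φ ω)) {C : Set X} (hC : Convex ℝ C)
    (hCc : IsClosed C) : IsClosed (φ ⁻¹' C) := by
  rw [isClosed_iff_ultrafilter]
  exact fun ω U hU hω => mem_of_forall_tendsto_dual (l := (U : Filter Ω)) (u := φ) hC hCc hω
    fun f => ((hφ f).tendsto ω).mono_left hU

lemma weaklyCompact_range {Ω : Type*} [TopologicalSpace Ω] [CompactSpace Ω] {φ : Ω → X}
    (hφ : ∀ f : X →L[ℝ] ℝ, Continuous fun ω => f (φ ω)) : WeaklyCompact (range φ) := by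
  rw [WeaklyCompact, ← range_comp]
  refine isCompact_range (continuous_iff_continuousAt.2 fun ω => ?_)
  exact tendsto_toWeakSpace_iff.2 fun f => (hφ f).tendsto ω

lemma stronglyMeasurable_of_continuous_dual {Ω : Type*} [TopologicalSpace Ω]
    [MeasurableSpace Ω] [BorelSpace Ω] {φ : Ω → X}
    (hφ : ∀ f : X →L[ℝ] ℝ, Continuous fun ω => f (φ ω)) (hsep : IsSeparable (range φ)) :
    StronglyMeasurable φ := by
  borelize X
  refine stronglyMeasurable_iff_measurable_separable.2 ⟨measurable_of_isOpen fun U hU => ?_, hsep⟩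
  obtain ⟨D, hD, hsub⟩ := hsep
  have : φ ⁻¹' U = ⋃ d ∈ D, ⋃ q ∈ {q : ℚ | Metric.closedBall d (q : ℝ) ⊆ U},
      φ ⁻¹' Metric.closedBall d (q : ℝ) := by
    ext ω
    simp only [mem_preimage, mem_iUnion, exists_prop, mem_ofPred_eq]
    refine ⟨fun hω => ?_, fun ⟨d, _, q, hq, h⟩ => hq h⟩
    obtain ⟨ε, hε, hball⟩ := Metric.isOpen_iff.1 hU _ hω
    obtain ⟨q, hq0, hq⟩ := exists_rat_btwn (half_pos hε)
    obtain ⟨d, hd, hdist⟩ := Metric.mem_closure_iff.1 (hsub (mem_range_self ω)) q hq0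
    refine ⟨d, hd, q, fun y hy => hball ?_, hdist.le⟩
    have := dist_triangle_right y (φ ω) d
    rw [Metric.mem_closedBall] at hy
    rw [Metric.mem_ball]
    linarith
  rw [this]
  refine .biUnion hD fun d _ => .biUnion (to_countable _) fun q _ => ?_
  exact (isClosed_preimage_of_convex hφ (convex_closedBall d q)
    Metric.isClosed_closedBall).measurableSet

lemma exists_convex_weaklyCompact_superset_range [CompleteSpace X] {Ω : Type*}
    [TopologicalSpace Ω] [CompactSpace Ω] [T2Space Ω] {φ : Ω → X}
    (hφ : ∀ f : X →L[ℝ] ℝ, Continuous fun ω => f (φ ω)) (hsep : IsSeparable (range φ))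
    {R : ℝ} (hR : ∀ ω, ‖φ ω‖ ≤ R) :
    ∃ L : Set X, Convex ℝ L ∧ WeaklyCompact L ∧ range φ ⊆ L := by
  borelize Ω
  have hmeas := stronglyMeasurable_of_continuous_dual hφ hsep
  have hint : ∀ (μ : Measure Ω) [IsFiniteMeasure μ], Integrable φ μ := fun μ _ =>
    .of_bound hmeas.aestronglyMeasurable R (.of_forall hR)
  refine ⟨range fun μ : ProbabilityMeasure Ω => ∫ ω, φ ω ∂μ, ?_, weaklyCompact_range fun f => ?_,
    ?_⟩
  · rintro _ ⟨μ, rfl⟩ _ ⟨ν, rfl⟩ a b ha hb hab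
    lift a to NNReal using ha
    lift b to NNReal using hb
    have hab' : a + b = 1 := by exact_mod_cast hab
    refine ⟨⟨a • (μ : Measure Ω) + b • (ν : Measure Ω), ⟨?_⟩⟩, ?_⟩
    · simp only [Measure.add_apply, Measure.smul_apply, measure_univ, ENNReal.smul_def,
        smul_eq_mul, mul_one]
      exact_mod_cast hab'
    · simp only [ProbabilityMeasure.coe_mk]
      rw [integral_add_measure (hint _) (hint _), integral_smul_nnreal_measure,
        integral_smul_nnreal_measure]
      rfl
  · simp only [← f.integral_comp_comm (hint _)]
    exact ProbabilityMeasure.continuous_integral_continuousMap (ContinuousMap.mk _ (hφ f))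
  · rintro _ ⟨ω, rfl⟩
    exact ⟨⟨Measure.dirac ω, inferInstance⟩, integral_dirac _ _⟩

lemma WeaklyCompact.exists_eq_range {K : Set X} (hK : WeaklyCompact K) :
    ∃ (Ω : Set (WeakSpace ℝ X)) (φ : Ω → X), CompactSpace Ω ∧
      (∀ f : X →L[ℝ] ℝ, Continuous fun ω => f (φ ω)) ∧ φ.Injective ∧ range φ = K := by
  refine ⟨toWeakSpace ℝ X '' K, fun k => (toWeakSpace ℝ X).symm k, isCompact_iff_compactSpace.1 hK,
    fun f => ?_, fun _ _ h => Subtype.ext ((toWeakSpace ℝ X).symm.injective h), ?_⟩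
  · exact (WeakBilin.eval_continuous (topDualPairing ℝ X).flip f).comp continuous_subtype_val
  · ext x
    simp

lemma WeaklyCompact.exists_convex_superset [CompleteSpace X] {K : Set X}
    (hK : WeaklyCompact K) (hsep : IsSeparable K) (hbdd : Bornology.IsBounded K) :
    ∃ L : Set X, Convex ℝ L ∧ WeaklyCompact L ∧ K ⊆ L := by
  obtain ⟨R, hR⟩ := hbdd.exists_norm_le
  obtain ⟨Ω, φ, _, hφ, -, rfl⟩ := hK.exists_eq_range
  exact exists_convex_weaklyCompact_superset_range hφ hsep fun ω => hR _ (mem_range_self ω)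

end WeakKrein

section FixedPointOnWeaklyCompact

open Set TopologicalSpace

lemma exists_seq_dual_separating {A : Set X} (hA : IsSeparable A) :
    ∃ f : ℕ → X →L[ℝ] ℝ, ∀ x ∈ A, ∀ y ∈ A, (∀ n, f n x = f n y) → x = y := by
  obtain ⟨D, hD, hsub⟩ := hA.span (R := ℝ)
  have hne : D.Nonempty := closure_nonempty_iff.1 ⟨0, hsub (Submodule.zero_mem _)⟩
  obtain ⟨d, rfl⟩ := hD.exists_eq_range hne
  choose f hf hfd using fun n => exists_dual_vector'' ℝ (d n)
  refine ⟨f, fun x hx y hy h => sub_eq_zero.1 (norm_le_zero_iff.1 (le_of_forall_pos_le_add ?_))⟩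
  intro ε hε
  obtain ⟨_, ⟨n, rfl⟩, hn⟩ := Metric.mem_closure_iff.1
    (hsub (sub_mem (Submodule.subset_span hx) (Submodule.subset_span hy))) _ (half_pos hε)
  rw [dist_eq_norm] at hn
  have h0 : f n (x - y) = 0 := by rw [map_sub, h, sub_self]
  have h1 : ‖d n‖ ≤ ‖(x - y) - d n‖ := by
    have h2 : f n (d n - (x - y)) = ‖d n‖ := by
      rw [map_sub, h0, sub_zero]
      exact hfd n
    rw [norm_sub_rev, ← h2]
    refine (le_abs_self _).trans (((f n).le_opNorm _).trans ?_)
    exact mul_le_of_le_one_left (norm_nonneg _) (hf n)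
  have h3 := norm_le_norm_sub_add (x - y) (d n)
  linarith

lemma WeaklyCompact.exists_subseq_weakConv {K : Set X} (hK : WeaklyCompact K)
    (hsep : IsSeparable K) {u : ℕ → X} (hu : ∀ n, u n ∈ K) :
    ∃ x ∈ K, ∃ φ : ℕ → ℕ, StrictMono φ ∧ WeakConv (u ∘ φ) x := by
  obtain ⟨f, hf⟩ := exists_seq_dual_separating hsep
  obtain ⟨Ω, ψ, _, hψ, hinj, rfl⟩ := hK.exists_eq_range
  have hcont : Continuous fun ω n => f n (ψ ω) := continuous_pi fun n => hψ (f n)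
  have hemb := hcont.isClosedEmbedding fun ω ω' h => hinj
    (hf _ (mem_range_self ω) _ (mem_range_self ω') (congrFun h))
  have := hemb.isEmbedding.metrizableSpace
  choose w hw using hu
  obtain ⟨ω, φ, hφ, hlim⟩ := CompactSpace.tendsto_subseq w
  refine ⟨ψ ω, mem_range_self ω, φ, hφ, fun g => ?_⟩
  have := ((hψ g).tendsto ω).comp hlim
  simpa only [Function.comp_def, hw] using this

lemma WeaklyCompact.exists_fixedPoint {K : Set X} (hK : WeaklyCompact K) (hne : K.Nonempty)
    (hconv : Convex ℝ K) (hbdd : Bornology.IsBounded K) (hsep : IsSeparable K) {T : X → X}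
    (hmaps : MapsTo T K K)
    (hwsc : ∀ (u : ℕ → X) (x : X), (∀ n, u n ∈ K) → x ∈ K →
      WeakConv u x → WeakConv (fun n => T (u n)) (T x)) :
    ∃ x ∈ K, T x = x := by
  obtain ⟨f, hf⟩ := exists_seq_dual_separating hsep
  have happrox : ∀ n : ℕ, ∃ x ∈ K, ∀ i : Fin (n + 1),
      |f i (T x) - f i x| ≤ 1 / ((n : ℝ) + 1) := fun n =>
    exists_forall_abs_sub_le_of_weaklySeqContinuous hne hconv hbdd hmaps hwsc
      (fun i : Fin (n + 1) => f i) Nat.one_div_pos_of_nat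
  choose u hu hfu using happrox
  obtain ⟨x, hx, φ, hφ, hlim⟩ := hK.exists_subseq_weakConv hsep hu
  refine ⟨x, hx, hf _ (hmaps hx) _ hx fun i => sub_eq_zero.1 (abs_eq_zero.1 ?_)⟩
  have hT := hwsc _ x (fun n => hu (φ n)) hx hlim
  refine tendsto_nhds_unique (((hT (f i)).sub (hlim (f i))).abs) ?_
  refine squeeze_zero' (.of_forall fun n => abs_nonneg _) ?_
    ((tendsto_one_div_add_atTop_nhds_zero_nat (𝕜 := ℝ)).comp hφ.tendsto_atTop)
  filter_upwards [eventually_ge_atTop i] with n hn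
  exact hfu (φ n) ⟨i, Nat.lt_succ_of_le (hn.trans (hφ.id_le n))⟩

end FixedPointOnWeaklyCompact

section DeBlasi

open Set TopologicalSpace

lemma deBlasi_nonneg (A : Set X) : 0 ≤ deBlasi A :=
  Real.sInf_nonneg fun _ hr => hr.1

lemma deBlasi_le {A K : Set X} {r : ℝ} (hr : 0 ≤ r) (hK : WeaklyCompact K)
    (h : A ⊆ K + Metric.closedBall (0 : X) r) : deBlasi A ≤ r :=
  csInf_le ⟨0, fun _ hs => hs.1⟩ ⟨hr, K, hK, h⟩

lemma exists_weaklyCompact_of_deBlasi_lt {A : Set X} (hA : Bornology.IsBounded A) {r : ℝ}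
    (hr : deBlasi A < r) :
    ∃ K : Set X, WeaklyCompact K ∧ A ⊆ K + Metric.closedBall (0 : X) r := by
  obtain ⟨R, hR0, hR⟩ := hA.exists_pos_norm_le
  have hne : {r : ℝ | 0 ≤ r ∧ ∃ K : Set X, WeaklyCompact K ∧
      A ⊆ K + Metric.closedBall (0 : X) r}.Nonempty := by
    refine ⟨R, hR0.le, {0}, by simp [WeaklyCompact], fun a ha => ?_⟩
    simpa using hR a ha
  obtain ⟨s, ⟨-, K, hK, hsub⟩, hs⟩ := exists_lt_of_csInf_lt hne hr
  exact ⟨K, hK, hsub.trans (add_subset_add_left (Metric.closedBall_subset_closedBall hs.le))⟩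

lemma TopologicalSpace.IsSeparable.closedConvexHull {A : Set X} (hA : IsSeparable A) :
    IsSeparable (closedConvexHull ℝ A) :=
  (hA.span (R := ℝ)).closure.mono <| closedConvexHull_min
    (Submodule.subset_span.trans subset_closure) (Submodule.span ℝ A).convex.closure
    isClosed_closure

lemma Bornology.IsBounded.closedConvexHull {A : Set X} (hA : Bornology.IsBounded A) :
    Bornology.IsBounded (closedConvexHull ℝ A) := by
  obtain ⟨R, hR⟩ := hA.subset_closedBall 0
  exact Metric.isBounded_closedBall.subset
    (closedConvexHull_min hR (convex_closedBall 0 R) Metric.isClosed_closedBall)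

lemma exists_separable_weaklyCompact_subset_add {A K : Set X} {r : ℝ} (hA : IsSeparable A)
    (hbdd : Bornology.IsBounded A) (hK : WeaklyCompact K)
    (h : A ⊆ K + Metric.closedBall (0 : X) r) :
    ∃ K' : Set X, WeaklyCompact K' ∧ IsSeparable K' ∧ Bornology.IsBounded K' ∧
      A ⊆ K' + Metric.closedBall (0 : X) r := by
  obtain ⟨R, hR⟩ := hbdd.exists_norm_le
  obtain ⟨D, hDA, hD, hAD⟩ := hA.exists_countable_dense_subset
  choose! k hk b hb hkb using fun a (ha : a ∈ A) => mem_add.1 (h ha)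
  set C := (Submodule.span ℝ (k '' D)).topologicalClosure with hC
  have hCs : IsSeparable (C : Set X) := (hD.image k).isSeparable.span.closure
  have hK' : WeaklyCompact (K ∩ C ∩ Metric.closedBall 0 (R + r)) :=
    (hK.inter_of_convex_of_isClosed C.convex
      (Submodule.isClosed_topologicalClosure _)).inter_of_convex_of_isClosed
      (convex_closedBall _ _) Metric.isClosed_closedBall
  refine ⟨_, hK', hCs.mono fun x hx => hx.1.2, Metric.isBounded_closedBall.subset
    inter_subset_right, hAD.trans (closure_minimal (fun a ha => ?_)
      (hK'.isClosed_add_closedBall r))⟩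
  have haA := hDA ha
  refine mem_add.2 ⟨k a, ⟨⟨hk a haA, ?_⟩, ?_⟩, b a, hb a haA, hkb a haA⟩
  · exact Submodule.le_topologicalClosure _ (Submodule.subset_span (mem_image_of_mem k ha))
  · have h1 := hb a haA
    rw [mem_closedBall_zero_iff] at h1 ⊢
    rw [eq_sub_of_add_eq (hkb a haA)]
    exact (norm_sub_le _ _).trans (add_le_add (hR a haA) h1)

lemma deBlasi_closedConvexHull_insert_le [CompleteSpace X] {A : Set X} (hA : IsSeparable A)
    (hbdd : Bornology.IsBounded A) (x : X) :
    deBlasi (closedConvexHull ℝ (insert x A)) ≤ deBlasi A := by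
  refine le_of_forall_gt_imp_ge_of_dense fun r hr => ?_
  have hr0 : 0 ≤ r := (deBlasi_nonneg A).trans hr.le
  obtain ⟨K, hK, hsub⟩ := exists_weaklyCompact_of_deBlasi_lt hbdd hr
  obtain ⟨K', hK', hsep, hbdd', hsub'⟩ :=
    exists_separable_weaklyCompact_subset_add hA hbdd hK hsub
  obtain ⟨L, hL, hLc, hKL⟩ := (hK'.insert x).exists_convex_superset
    (by rw [insert_eq]; exact (finite_singleton x).isSeparable.union hsep) (hbdd'.insert x)
  refine deBlasi_le hr0 hLc (closedConvexHull_min (insert_subset ?_ ?_)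
    (hL.add (convex_closedBall 0 r)) (hLc.isClosed_add_closedBall r))
  · exact mem_add.2 ⟨x, hKL (mem_insert _ _), 0, Metric.mem_closedBall_self hr0, add_zero x⟩
  · exact hsub'.trans (add_subset_add_right ((subset_insert _ _).trans hKL))

lemma weaklyCompact_of_deBlasi_eq_zero [CompleteSpace X] {K : Set X} (hconv : Convex ℝ K)
    (hcl : IsClosed K) (hbdd : Bornology.IsBounded K) (h : deBlasi K = 0) : WeaklyCompact K :=
  weaklyCompact_of_forall_subset_add_closedBall hconv hcl fun _ hε =>
    exists_weaklyCompact_of_deBlasi_lt hbdd (h.trans_lt hε)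

end DeBlasi

section InvariantSubsets

open Set TopologicalSpace

lemma exists_isSeparable_invariant_subset {S : Set X} (hcl : IsClosed S) (hconv : Convex ℝ S)
    {T : X → X} (hmaps : MapsTo T S S)
    (hwsc : ∀ (u : ℕ → X) (x : X), (∀ n, u n ∈ S) → x ∈ S →
      WeakConv u x → WeakConv (fun n => T (u n)) (T x)) {x₀ : X} (hx₀ : x₀ ∈ S) :
    ∃ C ⊆ S, IsClosed C ∧ Convex ℝ C ∧ IsSeparable C ∧ x₀ ∈ C ∧ MapsTo T C C := by
  have hdense : ∀ W : Set X, ∃ D : Set X, W.Countable →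
      D.Countable ∧ W ⊆ D ∧ D ⊆ closedConvexHull ℝ W ∧ closedConvexHull ℝ W ⊆ closure D := by
    intro W
    by_cases hW : W.Countable
    · obtain ⟨D, hDW, hD, hWD⟩ := hW.isSeparable.closedConvexHull.exists_countable_dense_subset
      exact ⟨W ∪ D, fun _ => ⟨hW.union hD, subset_union_left,
        union_subset subset_closedConvexHull hDW, hWD.trans (closure_mono subset_union_right)⟩⟩
    · exact ⟨∅, fun h => absurd h hW⟩
  choose D hD using hdense
  let W : ℕ → Set X := fun n => Nat.rec {x₀} (fun _ W => D (W ∪ T '' W)) n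
  have hWc : ∀ n, (W n).Countable := by
    intro n
    induction n with
    | zero => exact countable_singleton x₀
    | succ n ih => exact (hD _ (ih.union (ih.image T))).1
  have hWD := fun n => hD _ ((hWc n).union ((hWc n).image T))
  have hWS : ∀ n, W n ⊆ S := by
    intro n
    induction n with
    | zero => exact singleton_subset_iff.2 hx₀
    | succ n ih =>
      exact (hWD n).2.2.1.trans (closedConvexHull_min
        (union_subset ih (image_subset_iff.2 fun x hx => hmaps (ih hx))) hconv hcl)
  have hmono : Monotone W := monotone_nat_of_le_succ fun n => subset_union_left.trans (hWD n).2.1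
  have hTW : ∀ n, T '' W n ⊆ W (n + 1) := fun n => subset_union_right.trans (hWD n).2.1
  have hWconv : ∀ n, Convex ℝ (closure (W (n + 1))) := by
    intro n
    have : closure (W (n + 1)) = closedConvexHull ℝ (W n ∪ T '' W n) :=
      (closure_minimal (hWD n).2.2.1 isClosed_closedConvexHull).antisymm (hWD n).2.2.2
    rw [this]
    exact convex_closedConvexHull
  have hclosure : closure (⋃ n, W n) = closure (⋃ n, closure (W (n + 1))) := by
    refine Subset.antisymm (closure_mono (iUnion_mono fun n => ?_)) (closure_minimal
      (iUnion_subset fun n => closure_mono (subset_iUnion W (n + 1))) isClosed_closure)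
    exact (hmono n.le_succ).trans subset_closure
  have hCS : closure (⋃ n, W n) ⊆ S := closure_minimal (iUnion_subset hWS) hcl
  have hCconv : Convex ℝ (closure (⋃ n, W n)) := by
    rw [hclosure]
    refine (Directed.convex_iUnion (Monotone.directed_le fun n m h => ?_)
      fun {n} => hWconv n).closure
    exact closure_mono (hmono (Nat.succ_le_succ h))
  refine ⟨closure (⋃ n, W n), hCS, isClosed_closure, hCconv,
    (countable_iUnion hWc).isSeparable.closure, subset_closure (mem_iUnion.2 ⟨0, rfl⟩), ?_⟩
  intro x hx
  obtain ⟨u, hu, hlim⟩ := mem_closure_iff_seq_limit.1 hx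
  refine mem_of_forall_tendsto_dual (l := atTop) (u := fun n => T (u n)) hCconv isClosed_closure
    (.of_forall fun n => ?_) (hwsc u x (fun n => hCS (subset_closure (hu n))) (hCS hx)
      fun f => (f.continuous.tendsto x).comp hlim)
  obtain ⟨m, hm⟩ := mem_iUnion.1 (hu n)
  exact subset_closure (mem_iUnion.2 ⟨m + 1, hTW m (mem_image_of_mem T hm)⟩)

lemma exists_invariant_subset_closedConvexHull {C : Set X} (hcl : IsClosed C)
    (hconv : Convex ℝ C) {T : X → X} (hmaps : MapsTo T C C) {x₀ : X} (hx₀ : x₀ ∈ C) :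
    ∃ K ⊆ C, x₀ ∈ K ∧ MapsTo T K K ∧ K = closedConvexHull ℝ (insert x₀ (T '' K)) := by
  set 𝓜 : Set (Set X) := {M | M ⊆ C ∧ IsClosed M ∧ Convex ℝ M ∧ x₀ ∈ M ∧ MapsTo T M M}
  have hC : C ∈ 𝓜 := ⟨Subset.rfl, hcl, hconv, hx₀, hmaps⟩
  have hK : ⋂₀ 𝓜 ∈ 𝓜 := ⟨sInter_subset_of_mem hC, isClosed_sInter fun M hM => hM.2.1,
    convex_sInter fun M hM => hM.2.2.1, fun M hM => hM.2.2.2.1,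
    fun x hx M hM => hM.2.2.2.2 (hx M hM)⟩
  obtain ⟨hKC, hKcl, hKconv, hKx, hKT⟩ := hK
  have hsub : closedConvexHull ℝ (insert x₀ (T '' ⋂₀ 𝓜)) ⊆ ⋂₀ 𝓜 :=
    closedConvexHull_min (insert_subset hKx hKT.image_subset) hKconv hKcl
  refine ⟨⋂₀ 𝓜, hKC, hKx, hKT, Subset.antisymm (sInter_subset_of_mem ?_) hsub⟩
  exact ⟨hsub.trans hKC, isClosed_closedConvexHull, convex_closedConvexHull,
    subset_closedConvexHull (mem_insert _ _), fun x hx =>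
      subset_closedConvexHull (mem_insert_of_mem _ (mem_image_of_mem T (hsub hx)))⟩

end InvariantSubsets

/-- A weakly sequentially continuous self-map of a nonempty closed convex
subset of a real Banach space, with bounded range, which is condensing with respect to
the De Blasi measure of weak noncompactness, has a fixed point. -/
theorem fixedPoint_of_weaklySeqContinuous_condensing {X : Type*}
    [NormedAddCommGroup X] [NormedSpace ℝ X] [CompleteSpace X]
    (S : Set X) (hne : S.Nonempty) (hcl : IsClosed S) (hconv : Convex ℝ S)
    (T : X → X) (hmaps : Set.MapsTo T S S)
    (hwsc : ∀ (u : ℕ → X) (x : X), (∀ n, u n ∈ S) → x ∈ S →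
      WeakConv u x → WeakConv (fun n => T (u n)) (T x))
    (hbdd : Bornology.IsBounded (T '' S))
    (hcond : ∀ V ⊆ S, Bornology.IsBounded V → 0 < deBlasi V →
      deBlasi (T '' V) < deBlasi V) :
    ∃ x ∈ S, T x = x := by
  obtain ⟨x₀, hx₀⟩ := hne
  obtain ⟨C, hCS, hCcl, hCconv, hCsep, hxC, hCT⟩ :=
    exists_isSeparable_invariant_subset hcl hconv hmaps hwsc hx₀
  obtain ⟨K, hKC, hxK, hKT, hK⟩ :=
    exists_invariant_subset_closedConvexHull hCcl hCconv hCT hxC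
  have hKS := hKC.trans hCS
  have hTK : Bornology.IsBounded (T '' K) := hbdd.subset (Set.image_mono hKS)
  have hKconv : Convex ℝ K := hK ▸ convex_closedConvexHull
  have hKcl : IsClosed K := hK ▸ isClosed_closedConvexHull
  have hKbdd : Bornology.IsBounded K := hK ▸ (hTK.insert x₀).closedConvexHull
  have hle : deBlasi K ≤ deBlasi (T '' K) := by
    have := deBlasi_closedConvexHull_insert_le
      (hCsep.mono (hKT.image_subset.trans hKC)) hTK x₀
    rwa [← hK] at this
  have hzero : deBlasi K = 0 :=
    ((deBlasi_nonneg K).eq_or_lt.resolve_right fun h => (hcond K hKS hKbdd h).not_ge hle).symm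
  obtain ⟨x, hx, hTx⟩ :=
    (weaklyCompact_of_deBlasi_eq_zero hKconv hKcl hKbdd hzero).exists_fixedPoint ⟨x₀, hxK⟩
      hKconv hKbdd (hCsep.mono hKC) hKT fun u x hu hx => hwsc u x (fun n => hKS (hu n)) (hKS hx)
  exact ⟨x, hKS hx, hTx⟩
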